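/- Let λ > 0 and τ > 2. The function t ↦ q_scad(t; λ, τ) is convex on ℝ. Consequently, the function β ↦ Σᵢ₌₁^p q_scad(βᵢ; λ, τ) is convex on ℝ^p. -/

import Mathlib

/-- The function `q_scad(t; λ, τ)`. -/
noncomputable def qSCAD (lam tau t : ℝ) : ℝ :=
  if lam * tau < |t| then lam * |t| - lam ^ 2 * (tau + 1) / 2
  else if lam < |t| then (|t| - lam) ^ 2 / (2 * (tau - 1))
  else 0

/-- The affine-in-`|t|` functions with slope `s ∈ [0, λ]` lie below `q_scad(·; λ, τ)`. -/
theorem le_qSCAD {lam tau s : ℝ} (htau : 1 < tau) (hs : 0 ≤ s) (hsl : s ≤ lam) (t : ℝ) :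
    s * (|t| - lam) - s ^ 2 * (tau - 1) / 2 ≤ qSCAD lam tau t := by
  have hk : 0 < tau - 1 := sub_pos.mpr htau
  unfold qSCAD
  split_ifs with h₁ h₂
  · have h : 0 ≤ (lam - s) * (|t| - lam - (tau - 1) * (lam + s) / 2) := by
      apply mul_nonneg (by linarith)
      nlinarith [mul_nonneg hk.le (sub_nonneg.mpr hsl)]
    nlinarith
  · rw [le_div_iff₀ (by positivity)]
    nlinarith [sq_nonneg (|t| - lam - s * (tau - 1))]
  · nlinarith [mul_nonneg hs (sub_nonneg.mpr (not_lt.mp h₂)), mul_nonneg (sq_nonneg s) hk.le]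

/-- At every point, `q_scad(·; λ, τ)` agrees with one of its minorants from `le_qSCAD`. -/
theorem exists_qSCAD_eq {lam tau : ℝ} (hlam : 0 ≤ lam) (htau : 1 < tau) (t : ℝ) :
    ∃ s, 0 ≤ s ∧ s ≤ lam ∧ qSCAD lam tau t = s * (|t| - lam) - s ^ 2 * (tau - 1) / 2 := by
  have hk : 0 < tau - 1 := sub_pos.mpr htau
  unfold qSCAD
  split_ifs with h₁ h₂
  · exact ⟨lam, hlam, le_rfl, by ring⟩
  · refine ⟨(|t| - lam) / (tau - 1), div_nonneg (by linarith) hk.le, ?_, ?_⟩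
    · rw [div_le_iff₀ hk]
      linarith
    · field_simp
      ring
  · exact ⟨0, le_rfl, hlam, by ring⟩

theorem convexOn_qSCAD {lam tau : ℝ} (hlam : 0 ≤ lam) (htau : 1 < tau) :
    ConvexOn ℝ Set.univ (qSCAD lam tau) := by
  refine ⟨convex_univ, fun x _ y _ a b ha hb hab => ?_⟩
  obtain ⟨s, hs, hsl, h⟩ := exists_qSCAD_eq hlam htau (a • x + b • y)
  have habs : |a • x + b • y| ≤ a * |x| + b * |y| := by
    simpa [abs_mul, abs_of_nonneg ha, abs_of_nonneg hb] using abs_add_le (a * x) (b * y)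
  rw [h]
  calc s * (|a • x + b • y| - lam) - s ^ 2 * (tau - 1) / 2
      ≤ s * (a * |x| + b * |y| - lam) - s ^ 2 * (tau - 1) / 2 := by gcongr
    _ = a * (s * (|x| - lam) - s ^ 2 * (tau - 1) / 2)
        + b * (s * (|y| - lam) - s ^ 2 * (tau - 1) / 2) := by
      linear_combination (s * lam + s ^ 2 * (tau - 1) / 2) * hab
    _ ≤ a * qSCAD lam tau x + b * qSCAD lam tau y := by
      gcongr <;> exact le_qSCAD htau hs hsl _

/-- `q_scad(·; λ, τ)` is convex on `ℝ`, and consequently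
`β ↦ Σᵢ q_scad(βᵢ; λ, τ)` is convex on `ℝ^p`. -/
theorem qSCAD_convex {p : ℕ} (lam tau : ℝ) (hlam : 0 < lam) (htau : 2 < tau) :
    ConvexOn ℝ Set.univ (qSCAD lam tau) ∧
    ConvexOn ℝ Set.univ (fun β : Fin p → ℝ => ∑ i, qSCAD lam tau (β i)) := by
  have h := convexOn_qSCAD hlam.le (one_lt_two.trans htau)
  refine ⟨h, convex_univ, fun x _ y _ a b ha hb hab => ?_⟩
  simp only [Finset.smul_sum, ← Finset.sum_add_distrib]
  exact Finset.sum_le_sum fun i _ => h.2 (Set.mem_univ (x i)) (Set.mem_univ (y i)) ha hb hab
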